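/- arXiv:1408.2071 — 2 statements merged into one kernel-verified Lean document; each statement's English description precedes it below -/
import Mathlib

section
/- For every k with 0 ≤ k ≤ k*, the maximum degree of the induced subgraph G_k = G[V_k] is strictly less than D_k = n^(1/2^k); that is, every vertex of V_k has fewer than n^(1/2^k) neighbors inside V_k. -/
open Finset

noncomputable section
open scoped Classical

/-- `Dk n k = n^(1/2^k)` : the degree threshold at level `k`. -/
def Dk (n k : ℕ) : ℝ := (n : ℝ) ^ ((1 : ℝ) / (2 : ℝ) ^ k)

/-- `kstar n = ⌈log₂ log₂ n⌉`. -/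
def kstar (n : ℕ) : ℕ := ⌈Real.logb 2 (Real.logb 2 (n : ℝ))⌉₊

variable {V : Type} [Fintype V] [DecidableEq V]

/-- Number of `G`-neighbors of `v` lying inside the vertex set `s`;
for `v ∈ s` this is the degree of `v` in the induced subgraph `G[s]`. -/
def degIn (G : SimpleGraph V) (s : Finset V) (v : V) : ℕ :=
  (s.filter fun w => G.Adj v w).card

/-- The vertex sets `V_k` of the degree decomposition:
`V_0 = V` and `V_{k+1} = V_k \ U_{k+1}` where
`U_{k+1} = {v ∈ V_k : D_{k+1} ≤ deg_{G_k}(v) < D_k}`. -/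
def Vk (G : SimpleGraph V) (n : ℕ) : ℕ → Finset V
  | 0 => Finset.univ
  | k + 1 =>
    Vk G n k \
      (Vk G n k).filter fun v =>
        Dk n (k + 1) ≤ (degIn G (Vk G n k) v : ℝ) ∧ (degIn G (Vk G n k) v : ℝ) < Dk n k

/-- The classes `U_k` of the degree decomposition, for `1 ≤ k ≤ kstar n + 1`:
`U_k = {v ∈ V_{k-1} : D_k ≤ deg_{G_{k-1}}(v) < D_{k-1}}` for `k ≤ kstar n`, and
`U_{kstar n + 1} = V_{kstar n}`. -/
def Uk (G : SimpleGraph V) (n : ℕ) (k : ℕ) : Finset V :=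
  if k = kstar n + 1 then Vk G n (kstar n)
  else
    (Vk G n (k - 1)).filter fun v =>
      Dk n k ≤ (degIn G (Vk G n (k - 1)) v : ℝ) ∧ (degIn G (Vk G n (k - 1)) v : ℝ) < Dk n (k - 1)

theorem degIn_mono (G : SimpleGraph V) {s t : Finset V} (hst : s ⊆ t) (v : V) :
    degIn G s v ≤ degIn G t v :=
  card_le_card (filter_subset_filter _ hst)

theorem degIn_lt_card (G : SimpleGraph V) (s : Finset V) (v : V) :
    degIn G s v < Fintype.card V := by
  refine card_lt_card (ssubset_univ_iff.2 fun h => ?_)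
  have hv : v ∈ s.filter fun w => G.Adj v w := h ▸ mem_univ v
  exact G.loopless.irrefl v (mem_filter.1 hv).2

/-- For every `0 ≤ k ≤ k*`, the maximum degree of `G_k = G[V_k]` is strictly
less than `D_k = n^(1/2^k)`. -/
theorem maxDegree_Vk_lt (n : ℕ) (hn : 4 ≤ n) (G : SimpleGraph V)
    (hcard : Fintype.card V = n) (k : ℕ) (hk : k ≤ kstar n) :
    ∀ v ∈ Vk G n k, (degIn G (Vk G n k) v : ℝ) < Dk n k := by
  clear hk
  induction k with
  | zero =>
    intro v _
    have h := degIn_lt_card G (Vk G n 0) v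
    rw [hcard] at h
    simpa [Dk] using h
  | succ k ih =>
    intro v hv
    have hv' := hv
    simp only [Vk, mem_sdiff, mem_filter, not_and] at hv'
    have hdeg : (degIn G (Vk G n k) v : ℝ) < Dk n (k + 1) := by
      by_contra! h
      exact hv'.2 hv'.1 h (ih v hv'.1)
    exact (Nat.cast_le.2 (degIn_mono G sdiff_subset v)).trans_lt hdeg

end
end

section
/- Let H and H' be two simple graphs on the same vertex set V of size n, and let v ∈ V. Suppose the radius-k* balls around v agree: B_H(v,k*) = B_{H'}(v,k*) as vertex sets (where B_H(v,t) is the set of vertices at graph distance at most t from v in H), and the subgraphs of H and H' induced on this common set are identical. Then for every i with 1 ≤ i ≤ k*+1, v belongs to U_i in the degree decomposition of H if and only if v belongs to U_i in the degree decomposition of H'. -/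
open Finset

noncomputable section
open scoped Classical

variable {V : Type} [Fintype V] [DecidableEq V]

/-- The ball `B_H(v,t)`: the set of vertices reachable from `v` in `H` by a walk
of length at most `t` (equivalently, at graph distance at most `t`). -/
def gball (H : SimpleGraph V) (v : V) (t : ℕ) : Set V :=
  {w | ∃ p : H.Walk v w, p.length ≤ t}

theorem gball_mono (H : SimpleGraph V) (v : V) {s t : ℕ} (h : s ≤ t) :
    gball H v s ⊆ gball H v t :=
  fun _ ⟨p, hp⟩ => ⟨p, hp.trans h⟩

theorem mem_gball_succ_of_adj {H : SimpleGraph V} {v x w : V} {t : ℕ}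
    (hx : x ∈ gball H v t) (h : H.Adj x w) : w ∈ gball H v (t + 1) := by
  obtain ⟨p, hp⟩ := hx
  exact ⟨p.concat h, by simpa using hp⟩

theorem degIn_congr {H H' : SimpleGraph V} {s s' : Finset V} {x : V}
    (hadj : ∀ w, H.Adj x w ↔ H'.Adj x w) (hs : ∀ w, H.Adj x w → (w ∈ s ↔ w ∈ s')) :
    degIn H s x = degIn H' s' x := by
  unfold degIn
  congr 1
  ext w
  simp only [Finset.mem_filter, ← hadj w]
  exact and_congr_left (hs w)

/-- Graphs agreeing on a common ball of radius `K` have the same neighbors at every vertex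
lying at distance less than `K` from the center in both graphs. -/
theorem adj_iff_of_mem_gball {H H' : SimpleGraph V} {v x : V} {K d : ℕ}
    (hball : gball H v K = gball H' v K)
    (hind : ∀ x ∈ gball H v K, ∀ y ∈ gball H v K, (H.Adj x y ↔ H'.Adj x y))
    (hd : d + 1 ≤ K) (hx : x ∈ gball H v d) (hx' : x ∈ gball H' v d) (w : V) :
    H.Adj x w ↔ H'.Adj x w := by
  have hxK : x ∈ gball H v K := gball_mono H v (by omega) hx
  constructor
  · intro h
    exact (hind x hxK w (gball_mono H v hd (mem_gball_succ_of_adj hx h))).1 h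
  · intro h
    refine (hind x hxK w ?_).2 h
    rw [hball]
    exact gball_mono H' v hd (mem_gball_succ_of_adj hx' h)

theorem mem_Vk_iff_of_mem_gball {H H' : SimpleGraph V} {v : V} {K : ℕ} (n : ℕ)
    (hball : gball H v K = gball H' v K)
    (hind : ∀ x ∈ gball H v K, ∀ y ∈ gball H v K, (H.Adj x y ↔ H'.Adj x y)) (k : ℕ) :
    ∀ d, d + k ≤ K → ∀ x ∈ gball H v d, x ∈ gball H' v d →
      (x ∈ Vk H n k ↔ x ∈ Vk H' n k) := by
  induction k with
  | zero => intros; simp [Vk]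
  | succ k ih =>
    intro d hd x hx hx'
    have hadj := adj_iff_of_mem_gball hball hind (by omega) hx hx'
    have hdeg : degIn H (Vk H n k) x = degIn H' (Vk H' n k) x :=
      degIn_congr hadj fun w h => ih (d + 1) (by omega) w (mem_gball_succ_of_adj hx h)
        (mem_gball_succ_of_adj hx' ((hadj w).1 h))
    simp only [Vk, Finset.mem_sdiff, Finset.mem_filter, hdeg, ih d (by omega) x hx hx']

/-- If two graphs `H`, `H'` on the same vertex set have the same radius-`k*` ball
around `v` and induce identical subgraphs on this common ball, then for every
`1 ≤ i ≤ k* + 1`, `v ∈ U_i` in the degree decomposition of `H` iff `v ∈ U_i` in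
the degree decomposition of `H'`. -/
theorem mem_Uk_local (n : ℕ) (hn : 4 ≤ n) (H H' : SimpleGraph V)
    (hcard : Fintype.card V = n) (v : V)
    (hball : gball H v (kstar n) = gball H' v (kstar n))
    (hind : ∀ x ∈ gball H v (kstar n), ∀ y ∈ gball H v (kstar n),
      (H.Adj x y ↔ H'.Adj x y)) :
    ∀ i, 1 ≤ i → i ≤ kstar n + 1 → (v ∈ Uk H n i ↔ v ∈ Uk H' n i) := by
  have hself (G : SimpleGraph V) : v ∈ gball G v 0 := ⟨.nil, le_rfl⟩
  intro i hi hiK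
  have hV := mem_Vk_iff_of_mem_gball n hball hind
  unfold Uk
  split_ifs with h
  · exact hV _ 0 (by omega) v (hself H) (hself H')
  · have hadj := adj_iff_of_mem_gball hball hind (d := 0) (by omega) (hself H) (hself H')
    have hdeg : degIn H (Vk H n (i - 1)) v = degIn H' (Vk H' n (i - 1)) v :=
      degIn_congr hadj fun w hw => hV _ 1 (by omega) w (mem_gball_succ_of_adj (hself H) hw)
        (mem_gball_succ_of_adj (hself H') ((hadj w).1 hw))
    simp only [Finset.mem_filter, hdeg, hV (i - 1) 0 (by omega) v (hself H) (hself H')]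

end
end
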